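/- arXiv:2603.17584 — 5 statements merged into one kernel-verified Lean document; each statement's English description precedes it below -/
import Mathlib

section
/- Let G be a connected simple graph on n ≥ 2 vertices. Then the critical coupling satisfies 1/(n−1) ≤ τ_c(G) ≤ 1. -/
open Matrix

/-- The critical coupling of a finite simple graph `G`:
`τ_c(G) = sSup {t | 0 ≤ t ∧ ∀ τ ∈ [0, t), I + τ•A is invertible and
(I + τ•A)⁻¹ *ᵥ 𝟙 has all entries strictly positive}`. -/
noncomputable def criticalCoupling {V : Type*} [Fintype V] [DecidableEq V]
    (G : SimpleGraph V) [DecidableRel G.Adj] : ℝ :=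
  sSup {t : ℝ | 0 ≤ t ∧ ∀ τ ∈ Set.Ico (0 : ℝ) t,
    IsUnit (1 + τ • G.adjMatrix ℝ) ∧
    ∀ i, 0 < ((1 + τ • G.adjMatrix ℝ)⁻¹ *ᵥ fun _ => (1 : ℝ)) i}

theorem cc_upper {V : Type*} [Fintype V] [DecidableEq V]
    (G : SimpleGraph V) [DecidableRel G.Adj]
    (hn : 2 ≤ Fintype.card V) (hG : G.Connected) :
    ∃ τ : ℝ, 0 ≤ τ ∧ τ ≤ 1 ∧ ¬ IsUnit (1 + τ • G.adjMatrix ℝ) := by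
  haveI : Nontrivial V := Fintype.one_lt_card_iff_nontrivial.mp (by omega)
  obtain ⟨a, b, hab⟩ : ∃ a b, G.Adj a b := by
    obtain ⟨a⟩ := hG.nonempty
    obtain ⟨b, hb⟩ := hG.preconnected.exists_adj_of_nontrivial a
    exact ⟨a, b, hb⟩
  have hH : (1 + G.adjMatrix ℝ).IsHermitian := by
    ext i j
    simp [Matrix.one_apply, G.adj_comm, eq_comm]
  have hnp : ¬ (1 + G.adjMatrix ℝ).PosDef := by
    intro hp
    have hne : (Pi.single a 1 - Pi.single b 1 : V → ℝ) ≠ 0 := by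
      intro h
      have := congrFun h a
      simp [hab.ne] at this
    have h := hp.dotProduct_mulVec_pos hne
    simp [Matrix.mulVec_sub, sub_dotProduct, Matrix.add_apply, Matrix.one_apply, hab, hab.symm,
      hab.ne, hab.ne.symm] at h
  rw [hH.posDef_iff_eigenvalues_pos] at hnp
  push Not at hnp
  obtain ⟨i, hi⟩ := hnp
  set μ := hH.eigenvalues i with hμ
  have hv := hH.mulVec_eigenvectorBasis i
  rw [← hμ] at hv
  set v : V → ℝ := (hH.eigenvectorBasis i).ofLp with hvdef
  have hv0 : v ≠ 0 := by
    intro h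
    apply hH.eigenvectorBasis.toBasis.ne_zero i
    ext j
    have := congrFun h j
    simpa [hvdef] using this
  refine ⟨1 / (1 - μ), one_div_nonneg.mpr (by linarith), ?_, ?_⟩
  · rw [div_le_one (by linarith)]; linarith
  · intro hu
    apply hv0
    have hinj := Matrix.mulVec_injective_of_isUnit hu
    apply hinj
    rw [Matrix.mulVec_zero]
    have hA : G.adjMatrix ℝ *ᵥ v = (μ - 1) • v := by
      rw [Matrix.add_mulVec, Matrix.one_mulVec] at hv
      rw [sub_smul, one_smul, ← hv]; abel
    rw [Matrix.add_mulVec, Matrix.one_mulVec, Matrix.smul_mulVec, hA, smul_smul]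
    have : 1 / (1 - μ) * (μ - 1) = -1 := by
      have : 1 - μ ≠ 0 := by linarith
      field_simp; ring
    rw [this]; simp

theorem cc_lower {V : Type*} [Fintype V] [DecidableEq V]
    (G : SimpleGraph V) [DecidableRel G.Adj]
    (τ : ℝ) (h0 : 0 ≤ τ) (h1 : τ * ((Fintype.card V : ℝ) - 1) < 1) :
    IsUnit (1 + τ • G.adjMatrix ℝ) ∧
    ∀ i, 0 < ((1 + τ • G.adjMatrix ℝ)⁻¹ *ᵥ fun _ => (1 : ℝ)) i := by
  have hdeg : ∀ i, τ * (G.degree i : ℝ) ≤ τ * ((Fintype.card V : ℝ) - 1) := by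
    intro i
    have h : G.degree i + 1 ≤ Fintype.card V := G.degree_lt_card_verts i
    have h' : (G.degree i : ℝ) + 1 ≤ Fintype.card V := by exact_mod_cast h
    exact mul_le_mul_of_nonneg_left (by linarith) h0
  have hU : IsUnit (1 + τ • G.adjMatrix ℝ) := by
    rw [Matrix.isUnit_iff_isUnit_det, isUnit_iff_ne_zero]
    apply det_ne_zero_of_sum_row_lt_diag
    intro k
    have : ∑ j ∈ Finset.univ.erase k, ‖(1 + τ • G.adjMatrix ℝ) k j‖ = τ * G.degree k := by
      have h2 : ∀ j ∈ Finset.univ.erase k, ‖(1 + τ • G.adjMatrix ℝ) k j‖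
          = τ * G.adjMatrix ℝ k j := by
        intro j hj
        have hj' : k ≠ j := (Finset.ne_of_mem_erase hj).symm
        by_cases h : G.Adj k j <;> simp [Matrix.one_apply, hj', h, abs_of_nonneg h0]
      rw [Finset.sum_congr rfl h2, ← Finset.mul_sum, Finset.sum_erase _ (by simp)]
      congr 1
      simp [SimpleGraph.adjMatrix_apply, ← SimpleGraph.card_neighborFinset_eq_degree,
        SimpleGraph.neighborFinset_eq_filter]
    rw [this]
    simp
    linarith [hdeg k]
  refine ⟨hU, ?_⟩
  set x := (1 + τ • G.adjMatrix ℝ)⁻¹ *ᵥ fun _ => (1 : ℝ) with hx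
  have hxe : (1 + τ • G.adjMatrix ℝ) *ᵥ x = fun _ => (1 : ℝ) := by
    rw [hx, Matrix.mulVec_mulVec, Matrix.mul_nonsing_inv _ ((Matrix.isUnit_iff_isUnit_det _).mp hU),
      Matrix.one_mulVec]
  have he : ∀ i, x i = 1 - τ * ∑ j ∈ G.neighborFinset i, x j := by
    intro i
    have := congrFun hxe i
    rw [Matrix.add_mulVec, Matrix.one_mulVec, Matrix.smul_mulVec] at this
    simp only [Pi.add_apply, Pi.smul_apply, SimpleGraph.adjMatrix_mulVec_apply, smul_eq_mul] at this
    linarith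
  intro i
  haveI : Nonempty V := ⟨i⟩
  obtain ⟨k, hk⟩ := Finite.exists_min x
  refine lt_of_lt_of_le ?_ (hk i)
  by_contra hneg
  push Not at hneg
  set s := τ * ((Fintype.card V : ℝ) - 1)
  have hs0 : 0 ≤ s := le_trans (by positivity) (hdeg k)
  have hub : ∀ j, x j ≤ 1 - s * x k := by
    intro j
    have h3 : (G.degree j : ℝ) * x k ≤ ∑ l ∈ G.neighborFinset j, x l := by
      have := Finset.card_nsmul_le_sum (G.neighborFinset j) x (x k) (fun l _ => hk l)
      simpa using this
    have h4 := mul_le_mul_of_nonneg_left h3 h0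
    have h5 := mul_le_mul_of_nonneg_right (hdeg j) (neg_nonneg.mpr hneg)
    rw [he j]
    nlinarith
  have h6 : ∑ l ∈ G.neighborFinset k, x l ≤ (G.degree k : ℝ) * (1 - s * x k) := by
    have := Finset.sum_le_card_nsmul (G.neighborFinset k) x (1 - s * x k) (fun l _ => hub l)
    simpa using this
  have h7 := mul_le_mul_of_nonneg_left h6 h0
  have h8 : 0 ≤ 1 - s * x k := by nlinarith
  have h9 := mul_le_mul_of_nonneg_right (hdeg k) h8
  have h10 := he k
  nlinarith [mul_nonneg (mul_nonneg (sub_nonneg.mpr h1.le) (by linarith : 0 ≤ 1 + s)) (neg_nonneg.mpr hneg)]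

/-- For a connected simple graph on `n ≥ 2` vertices,
`1/(n-1) ≤ τ_c(G) ≤ 1`. -/
theorem criticalCoupling_bounds_connected {V : Type*} [Fintype V] [DecidableEq V]
    (G : SimpleGraph V) [DecidableRel G.Adj]
    (hn : 2 ≤ Fintype.card V) (hG : G.Connected) :
    1 / ((Fintype.card V : ℝ) - 1) ≤ criticalCoupling G ∧ criticalCoupling G ≤ 1 := by
  obtain ⟨τ₀, h0, h1, hτ⟩ := cc_upper G hn hG
  have hub : ∀ t ∈ {t : ℝ | 0 ≤ t ∧ ∀ τ ∈ Set.Ico (0 : ℝ) t,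
      IsUnit (1 + τ • G.adjMatrix ℝ) ∧
      ∀ i, 0 < ((1 + τ • G.adjMatrix ℝ)⁻¹ *ᵥ fun _ => (1 : ℝ)) i}, t ≤ 1 := by
    rintro t ⟨_, ht⟩
    by_contra hlt
    push Not at hlt
    exact hτ (ht τ₀ ⟨h0, by linarith⟩).1
  have hn' : (2 : ℝ) ≤ Fintype.card V := by exact_mod_cast hn
  have hpos : (0 : ℝ) < (Fintype.card V : ℝ) - 1 := by linarith
  have hmem : 1 / ((Fintype.card V : ℝ) - 1) ∈ {t : ℝ | 0 ≤ t ∧ ∀ τ ∈ Set.Ico (0 : ℝ) t,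
      IsUnit (1 + τ • G.adjMatrix ℝ) ∧
      ∀ i, 0 < ((1 + τ • G.adjMatrix ℝ)⁻¹ *ᵥ fun _ => (1 : ℝ)) i} := by
    refine ⟨by positivity, fun τ hτ => cc_lower G τ hτ.1 ?_⟩
    exact (lt_div_iff₀ hpos).mp hτ.2
  exact ⟨le_csSup ⟨1, hub⟩ hmem, csSup_le ⟨_, hmem⟩ hub⟩
end

section
/- Let G be a finite simple graph with maximum degree Δ ≥ 1. Then the critical coupling satisfies 1/Δ ≤ τ_c(G) ≤ 1. -/
open Matrix

lemma cc_exists_eig {V : Type*} [Fintype V] [DecidableEq V]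
    (G : SimpleGraph V) [DecidableRel G.Adj] {u v : V} (h : G.Adj u v) :
    ∃ l : ℝ, l ≤ -1 ∧ ∃ x : V → ℝ, x ≠ 0 ∧ G.adjMatrix ℝ *ᵥ x = l • x := by
  have hA : (G.adjMatrix ℝ).IsHermitian := by
    rw [Matrix.IsHermitian, Matrix.conjTranspose_eq_transpose_of_trivial]
    exact G.isSymm_adjMatrix
  have hB : (1 + G.adjMatrix ℝ).IsHermitian := Matrix.isHermitian_one.add hA
  have hne : u ≠ v := h.ne
  by_contra! hcon
  have hpd : (1 + G.adjMatrix ℝ).PosDef := by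
    rw [hB.posDef_iff_eigenvalues_pos]
    intro i
    by_contra! hi
    have he := hB.mulVec_eigenvectorBasis i
    refine hcon (hB.eigenvalues i - 1) (by linarith) (hB.eigenvectorBasis i) ?_ ?_
    · intro h0
      apply hB.eigenvectorBasis.toBasis.ne_zero i
      ext j
      simpa using congrFun h0 j
    · rw [Matrix.add_mulVec, Matrix.one_mulVec] at he
      rw [sub_smul, one_smul, ← he]
      simp
  have h2 := hpd.dotProduct_mulVec_pos (x := Pi.single u 1 - Pi.single v 1) (by
    intro h0
    have := congrFun h0 u
    simp [hne] at this)
  simp [Matrix.mulVec_sub, sub_dotProduct, Matrix.add_apply, h, h.symm, hne, hne.symm] at h2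

lemma cc_le_one {V : Type*} [Fintype V] [DecidableEq V]
    (G : SimpleGraph V) [DecidableRel G.Adj] {u v : V} (h : G.Adj u v) (t : ℝ)
    (ht : ∀ τ ∈ Set.Ico (0 : ℝ) t, IsUnit (1 + τ • G.adjMatrix ℝ)) : t ≤ 1 := by
  by_contra! h1
  obtain ⟨l, hl, x, hx, he⟩ := cc_exists_eig G h
  have hle : (-l)⁻¹ ≤ 1 := inv_le_one_of_one_le₀ (by linarith)
  have hu := ht (-l)⁻¹ ⟨inv_nonneg.2 (by linarith), by linarith⟩
  apply hx
  apply Matrix.mulVec_injective_of_isUnit hu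
  rw [Matrix.mulVec_zero, Matrix.add_mulVec, Matrix.one_mulVec, Matrix.smul_mulVec, he, smul_smul]
  have : (-l)⁻¹ * l = -1 := by
    have : l ≠ 0 := by linarith
    field_simp
  rw [this]; simp

lemma cc_unit {V : Type*} [Fintype V] [DecidableEq V]
    (G : SimpleGraph V) [DecidableRel G.Adj] (τ : ℝ) (h0 : 0 ≤ τ) (h1 : τ * G.maxDegree < 1) :
    IsUnit (1 + τ • G.adjMatrix ℝ) := by
  rw [Matrix.isUnit_iff_isUnit_det, isUnit_iff_ne_zero]
  apply det_ne_zero_of_sum_row_lt_diag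
  intro k
  have hd : (G.degree k : ℝ) ≤ G.maxDegree := by exact_mod_cast G.degree_le_maxDegree k
  have : ∑ j ∈ Finset.univ.erase k, ‖(1 + τ • G.adjMatrix ℝ) k j‖ ≤ τ * G.degree k := by
    calc _ = ∑ j ∈ Finset.univ.erase k, τ * G.adjMatrix ℝ k j := by
          apply Finset.sum_congr rfl
          intro j hj
          have : k ≠ j := (Finset.ne_of_mem_erase hj).symm
          simp only [Matrix.add_apply, Matrix.one_apply_ne this, Matrix.smul_apply, smul_eq_mul,
            zero_add, SimpleGraph.adjMatrix_apply]
          split_ifs <;> simp [h0]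
      _ ≤ ∑ j, τ * G.adjMatrix ℝ k j := by
          apply Finset.sum_le_sum_of_subset_of_nonneg (Finset.erase_subset _ _)
          intro j _ _
          simp only [SimpleGraph.adjMatrix_apply]
          split_ifs <;> simp [h0]
      _ = _ := by
          rw [← Finset.mul_sum]
          simp [SimpleGraph.adjMatrix_apply, ← SimpleGraph.card_neighborFinset_eq_degree,
            SimpleGraph.neighborFinset_eq_filter]
  refine this.trans_lt ?_
  simp
  nlinarith

lemma cc_pos {V : Type*} [Fintype V] [DecidableEq V]
    (G : SimpleGraph V) [DecidableRel G.Adj] (τ : ℝ) (h0 : 0 ≤ τ) (h1 : τ * G.maxDegree < 1)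
    (x : V → ℝ) (hx : (1 + τ • G.adjMatrix ℝ) *ᵥ x = fun _ => 1) (i : V) : 0 < x i := by
  have hd : ∀ k, (G.degree k : ℝ) ≤ G.maxDegree := fun k => by
    exact_mod_cast G.degree_le_maxDegree k
  have heq : ∀ k, x k + τ * ∑ j ∈ G.neighborFinset k, x j = 1 := fun k => by
    have := congrFun hx k
    rw [Matrix.add_mulVec, Matrix.one_mulVec, Matrix.smul_mulVec] at this
    simpa using this
  have : Nonempty V := ⟨i⟩
  obtain ⟨a, ha⟩ := Finite.exists_min x
  obtain ⟨b, hb⟩ := Finite.exists_max x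
  have hlow : ∀ k, G.degree k * x a ≤ ∑ j ∈ G.neighborFinset k, x j := fun k => by
    simpa using Finset.card_nsmul_le_sum (G.neighborFinset k) x (x a) (fun j _ => ha j)
  have hup : ∀ k, ∑ j ∈ G.neighborFinset k, x j ≤ G.degree k * x b := fun k => by
    simpa using Finset.sum_le_card_nsmul (G.neighborFinset k) x (x b) (fun j _ => hb j)
  refine lt_of_lt_of_le ?_ (ha i)
  by_contra! hm
  have hs0 : 0 ≤ τ * G.maxDegree := by positivity
  have e1 := mul_le_mul_of_nonneg_left (hup a) h0
  have e2 := mul_le_mul_of_nonneg_left (hlow b) h0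
  have e3 := heq a
  have e4 := heq b
  have hda : (0 : ℝ) ≤ G.degree a := by positivity
  have hM : 0 < x b := by
    by_contra! hM
    have : τ * (G.degree a * x b) ≤ 0 :=
      mul_nonpos_of_nonneg_of_nonpos h0 (mul_nonpos_of_nonneg_of_nonpos hda hM)
    linarith
  have f1 : τ * (G.degree a * x b) ≤ τ * G.maxDegree * x b := by
    rw [mul_assoc]; gcongr; exact G.degree_le_maxDegree a
  have f2 : τ * G.maxDegree * x a ≤ τ * (G.degree b * x a) := by
    rw [mul_assoc]
    exact mul_le_mul_of_nonneg_left (mul_le_mul_of_nonpos_right (hd b) hm) h0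
  set s := τ * G.maxDegree
  have g1 : 1 - s * x b ≤ x a := by linarith
  have g2 : x b ≤ 1 - s * x a := by linarith
  have g3 := mul_le_mul_of_nonneg_left g2 hs0
  have g4 : s * s * x a ≥ x a := by nlinarith
  nlinarith

/-- For a finite simple graph with maximum degree `Δ ≥ 1`,
`1/Δ ≤ τ_c(G) ≤ 1`. -/
theorem criticalCoupling_bounds_maxDegree {V : Type*} [Fintype V] [DecidableEq V]
    (G : SimpleGraph V) [DecidableRel G.Adj] (hΔ : 1 ≤ G.maxDegree) :
    1 / (G.maxDegree : ℝ) ≤ criticalCoupling G ∧ criticalCoupling G ≤ 1 := by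
  have hne : Nonempty V := by
    by_contra hV
    rw [not_nonempty_iff] at hV
    have : G.maxDegree = 0 := by simp
    omega
  obtain ⟨u, hu⟩ := G.exists_maximal_degree_vertex
  obtain ⟨v, hv⟩ : ∃ v, G.Adj u v := (G.degree_pos_iff_exists_adj u).1 (by omega)
  have hΔ' : (0 : ℝ) < G.maxDegree := by exact_mod_cast hΔ
  have hub : ∀ t ∈ {t : ℝ | 0 ≤ t ∧ ∀ τ ∈ Set.Ico (0 : ℝ) t,
      IsUnit (1 + τ • G.adjMatrix ℝ) ∧
      ∀ i, 0 < ((1 + τ • G.adjMatrix ℝ)⁻¹ *ᵥ fun _ => (1 : ℝ)) i}, t ≤ 1 := fun t ht =>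
    cc_le_one G hv t (fun τ hτ => (ht.2 τ hτ).1)
  refine ⟨le_csSup ⟨1, hub⟩ ⟨by positivity, fun τ hτ => ?_⟩, Real.sSup_le hub zero_le_one⟩
  have h1 : τ * G.maxDegree < 1 := (lt_div_iff₀ hΔ').1 hτ.2
  have hU := cc_unit G τ hτ.1 h1
  refine ⟨hU, cc_pos G τ hτ.1 h1 _ ?_⟩
  rw [Matrix.mulVec_mulVec, Matrix.mul_nonsing_inv _ ((Matrix.isUnit_iff_isUnit_det _).1 hU),
    Matrix.one_mulVec]
end

section
/- Let G be a connected simple graph on n ≥ 2 vertices with adjacency matrix A over ℝ, and set τ = 1/(n−1). Suppose x is a vector with 0 ≤ x_j ≤ 1 for every vertex j, satisfying (I + τ·A) ⬝ x = 𝟙, and suppose x_i = 0 for some vertex i. Then vertex i is adjacent to every other vertex, x_j = 1 for every neighbour j of i, and G is the star on n vertices centered at i (i.e., the only edges of G are those incident to i). -/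
open Matrix

/-- Let `G` be connected on `n ≥ 2` vertices and `τ = 1/(n-1)`. If
`0 ≤ x ≤ 1` solves `(I + τ • A) *ᵥ x = 𝟙` and `x_i = 0` for some vertex `i`, then `i` is
adjacent to every other vertex, `x_j = 1` for every neighbour `j` of `i`, and `G` is the
star centered at `i` (every edge of `G` is incident to `i`). -/
theorem star_uniqueness_at_lower_bound {V : Type*} [Fintype V] [DecidableEq V]
    (G : SimpleGraph V) [DecidableRel G.Adj]
    (hn : 2 ≤ Fintype.card V) (hG : G.Connected)
    (x : V → ℝ) (hx0 : ∀ j, 0 ≤ x j) (hx1 : ∀ j, x j ≤ 1)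
    (heq : (1 + (1 / ((Fintype.card V : ℝ) - 1)) • G.adjMatrix ℝ) *ᵥ x = fun _ => (1 : ℝ))
    (i : V) (hi : x i = 0) :
    (∀ j, j ≠ i → G.Adj i j) ∧ (∀ j, G.Adj i j → x j = 1) ∧
      (∀ j k, G.Adj j k → j = i ∨ k = i) := by
  have hn' : (0:ℝ) < (Fintype.card V : ℝ) - 1 := by
    have : (2:ℝ) ≤ (Fintype.card V : ℝ) := by exact_mod_cast hn
    linarith
  have row : ∀ j, ∑ k, (if G.Adj j k then x k else 0)
      = ((Fintype.card V : ℝ) - 1) * (1 - x j) := by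
    intro j
    have h := congrFun heq j
    rw [Matrix.add_mulVec, Matrix.one_mulVec, Matrix.smul_mulVec] at h
    simp only [Pi.add_apply, Pi.smul_apply, smul_eq_mul, Matrix.mulVec, dotProduct,
      SimpleGraph.adjMatrix_apply, ite_mul, one_mul, zero_mul] at h
    field_simp at h
    linarith
  have hnn : ∀ k ∈ Finset.univ.erase i, 0 ≤ 1 - (if G.Adj i k then x k else 0) := by
    intro k _
    have := hx1 k
    split_ifs <;> linarith
  have hsum : ∑ k ∈ Finset.univ.erase i, (1 - (if G.Adj i k then x k else 0)) = 0 := by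
    have h1 := Finset.add_sum_erase Finset.univ
      (fun k => 1 - (if G.Adj i k then x k else 0)) (Finset.mem_univ i)
    have h2 : ∑ k, (1 - (if G.Adj i k then x k else 0)) = 1 := by
      rw [Finset.sum_sub_distrib, row i, hi]
      simp
    rw [h2, if_neg (G.loopless.irrefl i)] at h1
    linarith
  have key : ∀ k, k ≠ i → G.Adj i k ∧ x k = 1 := by
    intro k hk
    have h := (Finset.sum_eq_zero_iff_of_nonneg hnn).1 hsum k (by simp [hk])
    split_ifs at h with ha
    · exact ⟨ha, by linarith⟩
    · norm_num at h
  refine ⟨fun j hj => (key j hj).1, fun j hj => (key j hj.ne').2, fun j k hjk => ?_⟩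
  by_contra! hc
  have h := row j
  rw [(key j hc.1).2, sub_self, mul_zero, Finset.sum_eq_zero_iff_of_nonneg] at h
  · have h2 := h k (Finset.mem_univ k)
    rw [if_pos hjk, (key k hc.2).2] at h2
    norm_num at h2
  · intro k _
    have := hx0 k
    split_ifs <;> linarith
end

section
/- Let n ≥ 2 and let K_n be the complete graph on n vertices. Then the critical coupling satisfies τ_c(K_n) = 1. -/
open Matrix

lemma complete_mulVec (n : ℕ) (τ : ℝ) (v : Fin n → ℝ) (i : Fin n) :
    ((1 + τ • (⊤ : SimpleGraph (Fin n)).adjMatrix ℝ) *ᵥ v) i = (1 - τ) * v i + τ * ∑ j, v j := by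
  have h : ((⊤ : SimpleGraph (Fin n)).adjMatrix ℝ *ᵥ v) i = ∑ j, v j - v i := by
    rw [eq_sub_iff_add_eq, ← Finset.sum_erase_add _ _ (Finset.mem_univ i)]
    congr 1
    rw [SimpleGraph.adjMatrix_mulVec_apply]
    apply Finset.sum_congr _ (fun _ _ => rfl)
    ext j
    simp [eq_comm]
  rw [Matrix.add_mulVec, Matrix.one_mulVec, Matrix.smul_mulVec, Pi.add_apply, Pi.smul_apply, h,
    smul_eq_mul]
  ring

/-- For the complete graph on `n ≥ 2` vertices, `τ_c(K_n) = 1`. -/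
theorem criticalCoupling_complete (n : ℕ) (hn : 2 ≤ n) :
    criticalCoupling (⊤ : SimpleGraph (Fin n)) = 1 := by
  have key : {t : ℝ | 0 ≤ t ∧ ∀ τ ∈ Set.Ico (0 : ℝ) t,
      IsUnit (1 + τ • (⊤ : SimpleGraph (Fin n)).adjMatrix ℝ) ∧
      ∀ i, 0 < ((1 + τ • (⊤ : SimpleGraph (Fin n)).adjMatrix ℝ)⁻¹ *ᵥ fun _ => (1 : ℝ)) i}
      = Set.Icc 0 1 := by
    ext t
    constructor
    · rintro ⟨h0, h⟩
      refine ⟨h0, ?_⟩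
      by_contra! ht
      have hu := (h 1 ⟨zero_le_one, ht⟩).1
      have hinj := Matrix.mulVec_injective_iff_isUnit.mpr hu
      let a : Fin n := ⟨0, by omega⟩
      let b : Fin n := ⟨1, by omega⟩
      have hab : a ≠ b := by simp [a, b]
      have e := @hinj (Pi.single a 1) (Pi.single b 1) (by
        ext i
        simp only [complete_mulVec]
        simp)
      have e2 := congrFun e a
      simp [hab] at e2
    · rintro ⟨h0, h1⟩
      refine ⟨h0, fun τ ⟨hτ0, hτt⟩ => ?_⟩
      have hτ1 : 0 < 1 - τ := by linarith
      have hc : 0 < (1 - τ) + τ * n := by positivity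
      have hu : IsUnit (1 + τ • (⊤ : SimpleGraph (Fin n)).adjMatrix ℝ) := by
        rw [← Matrix.mulVec_injective_iff_isUnit]
        intro v w hvw
        have hi : ∀ i, (1 - τ) * v i + τ * ∑ j, v j = (1 - τ) * w i + τ * ∑ j, w j := by
          intro i
          rw [← complete_mulVec, ← complete_mulVec]
          exact congrFun hvw i
        have hs : ∑ i, ((1 - τ) * v i + τ * ∑ j, v j) = ∑ i, ((1 - τ) * w i + τ * ∑ j, w j) :=
          Finset.sum_congr rfl fun i _ => hi i
        simp only [Finset.sum_add_distrib, ← Finset.mul_sum, Finset.sum_const, Finset.card_univ,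
          Fintype.card_fin, nsmul_eq_mul] at hs
        have hs2 : ∑ j, v j = ∑ j, w j := by
          apply mul_left_cancel₀ hc.ne'
          linarith
        ext i
        have := hi i
        rw [hs2] at this
        exact mul_left_cancel₀ hτ1.ne' (by linarith)
      refine ⟨hu, fun i => ?_⟩
      have hone : (fun _ => (1 : ℝ)) = (1 + τ • (⊤ : SimpleGraph (Fin n)).adjMatrix ℝ) *ᵥ
          (fun _ => ((1 - τ) + τ * n)⁻¹) := by
        ext i
        rw [complete_mulVec]
        simp only [Finset.sum_const, Finset.card_univ, Fintype.card_fin, nsmul_eq_mul]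
        field_simp
      rw [hone, Matrix.mulVec_mulVec,
        Matrix.nonsing_inv_mul _ ((Matrix.isUnit_iff_isUnit_det _).mp hu), Matrix.one_mulVec]
      positivity
  unfold criticalCoupling
  rw [key]
  exact csSup_Icc zero_le_one
end

section
/- Let M be a real symmetric positive definite n×n matrix and let x ∈ ℝ^n be a vector with every entry strictly positive. Then every complex eigenvalue of the matrix product diag(x) ⬝ M has strictly positive real part; consequently every complex eigenvalue of −diag(x) ⬝ M has strictly negative real part. -/
open Matrix

theorem diag_mul_aux {n : ℕ}
    (M : Matrix (Fin n) (Fin n) ℝ) (hM : M.PosDef)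
    (x : Fin n → ℝ) (hx : ∀ i, 0 < x i) (μ : ℂ) (v : Fin n → ℂ) (hv : v ≠ 0)
    (h : ((Matrix.diagonal x * M).map (Complex.ofReal ·)) *ᵥ v = μ • v) : 0 < μ.re := by
  set a : Fin n → ℝ := fun i => (v i).re with ha
  set b : Fin n → ℝ := fun i => (v i).im with hb
  have e1 : ∀ i, x i * (M *ᵥ a) i = μ.re * a i - μ.im * b i := by
    intro i
    have := congrArg Complex.re (congrFun h i)
    simpa [Matrix.mulVec, dotProduct, Finset.mul_sum, mul_assoc, ha, hb] using this
  have e2 : ∀ i, x i * (M *ᵥ b) i = μ.re * b i + μ.im * a i := by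
    intro i
    have := congrArg Complex.im (congrFun h i)
    simpa [Matrix.mulVec, dotProduct, Finset.mul_sum, mul_assoc, ha, hb] using this
  have pa : 0 ≤ a ⬝ᵥ (M *ᵥ a) := by simpa using hM.posSemidef.dotProduct_mulVec_nonneg a
  have pb : 0 ≤ b ⬝ᵥ (M *ᵥ b) := by simpa using hM.posSemidef.dotProduct_mulVec_nonneg b
  have hpos : 0 < a ⬝ᵥ (M *ᵥ a) + b ⬝ᵥ (M *ᵥ b) := by
    by_cases h0 : a = 0
    · have hb0 : b ≠ 0 := by
        intro hb0
        apply hv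
        funext i
        exact Complex.ext (congrFun h0 i) (congrFun hb0 i)
      have : 0 < b ⬝ᵥ (M *ᵥ b) := by simpa using hM.dotProduct_mulVec_pos hb0
      linarith
    · have : 0 < a ⬝ᵥ (M *ᵥ a) := by simpa using hM.dotProduct_mulVec_pos h0
      linarith
  have key : a ⬝ᵥ (M *ᵥ a) + b ⬝ᵥ (M *ᵥ b) = μ.re * ∑ i, (a i ^ 2 + b i ^ 2) / x i := by
    simp only [dotProduct]
    rw [← Finset.sum_add_distrib, Finset.mul_sum]
    refine Finset.sum_congr rfl fun i _ => ?_
    have hxi := (hx i).ne'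
    rw [← mul_div_assoc, eq_div_iff hxi]
    linear_combination a i * e1 i + b i * e2 i
  rw [key] at hpos
  refine pos_of_mul_pos_left hpos (Finset.sum_nonneg fun i _ => ?_)
  have := hx i
  positivity

/-- If `M` is a real symmetric positive definite matrix and `x` has strictly
positive entries, then every complex eigenvalue of `diag(x) * M` has strictly positive real
part; consequently every complex eigenvalue of `-diag(x) * M` has strictly negative real
part. -/
theorem diag_mul_posDef_eigenvalues_re_pos {n : ℕ}
    (M : Matrix (Fin n) (Fin n) ℝ) (hM : M.PosDef)
    (x : Fin n → ℝ) (hx : ∀ i, 0 < x i) :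
    (∀ μ : ℂ, (∃ v : Fin n → ℂ, v ≠ 0 ∧
        ((Matrix.diagonal x * M).map (Complex.ofReal ·)) *ᵥ v = μ • v) → 0 < μ.re) ∧
      ∀ μ : ℂ, (∃ v : Fin n → ℂ, v ≠ 0 ∧
        ((-(Matrix.diagonal x * M)).map (Complex.ofReal ·)) *ᵥ v = μ • v) → μ.re < 0 := by
  refine ⟨fun μ ⟨v, hv, h⟩ => diag_mul_aux M hM x hx μ v hv h, fun μ ⟨v, hv, h⟩ => ?_⟩
  have := diag_mul_aux M hM x hx (-μ) v hv (by
    rw [neg_smul, ← h]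
    ext i
    simp [Matrix.mulVec, dotProduct])
  simpa using this
end
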